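/- arXiv:1704.01319 — 2 statements merged into one kernel-verified Lean document; each statement's English description precedes it below -/
import Mathlib

section
/- Let A be a finitely generated DG Poisson algebra over k and let (A^{ue}, α, β) be a universal enveloping algebra of A. Then the canonical map α : A -> A^{ue} is injective. -/
noncomputable section

open scoped DirectSum

/-- The sign `(-1)^m`, as an integer, for `m : ℤ`. -/
def sgn (m : ℤ) : ℤ := (Int.negOnePow m : ℤ)

/-- A differential graded Poisson algebra structure on a `ℤ`-graded `k`-algebra `A`,
whose grading is given by `𝒜`. -/
structure DGPoissonAlgebra (k : Type) [Field k] (A : Type) [Ring A] [Algebra k A]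
    (𝒜 : ℤ → Submodule k A) : Type where
  /-- the Poisson bracket -/
  br : A →ₗ[k] A →ₗ[k] A
  /-- the differential -/
  d : A →ₗ[k] A
  br_mem : ∀ ⦃i j : ℤ⦄ ⦃a b : A⦄, a ∈ 𝒜 i → b ∈ 𝒜 j → br a b ∈ 𝒜 (i + j)
  d_mem : ∀ ⦃i : ℤ⦄ ⦃a : A⦄, a ∈ 𝒜 i → d a ∈ 𝒜 (i + 1)
  antisymm : ∀ ⦃i j : ℤ⦄ ⦃a b : A⦄, a ∈ 𝒜 i → b ∈ 𝒜 j →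
    br a b = -(sgn (i * j) • br b a)
  jacobi : ∀ ⦃i j l : ℤ⦄ ⦃a b c : A⦄, a ∈ 𝒜 i → b ∈ 𝒜 j → c ∈ 𝒜 l →
    br a (br b c) = br (br a b) c + sgn (i * j) • br b (br a c)
  gcomm : ∀ ⦃i j : ℤ⦄ ⦃a b : A⦄, a ∈ 𝒜 i → b ∈ 𝒜 j → a * b = sgn (i * j) • (b * a)
  leibniz : ∀ ⦃i j l : ℤ⦄ ⦃a b c : A⦄, a ∈ 𝒜 i → b ∈ 𝒜 j → c ∈ 𝒜 l →
    br a (b * c) = br a b * c + sgn (i * j) • (b * br a c)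
  d_sq : ∀ a : A, d (d a) = 0
  d_br : ∀ ⦃i j : ℤ⦄ ⦃a b : A⦄, a ∈ 𝒜 i → b ∈ 𝒜 j →
    d (br a b) = br (d a) b + sgn i • br a (d b)
  d_mul : ∀ ⦃i j : ℤ⦄ ⦃a b : A⦄, a ∈ 𝒜 i → b ∈ 𝒜 j →
    d (a * b) = d a * b + sgn i • (a * d b)

/-- A differential graded algebra structure (i.e. a differential) on a `ℤ`-graded
`k`-algebra `B` with grading `ℬ`. -/
structure DGAlgebra (k : Type) [Field k] (B : Type) [Ring B] [Algebra k B]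
    (ℬ : ℤ → Submodule k B) : Type where
  /-- the differential -/
  d : B →ₗ[k] B
  d_mem : ∀ ⦃i : ℤ⦄ ⦃b : B⦄, b ∈ ℬ i → d b ∈ ℬ (i + 1)
  d_sq : ∀ b : B, d (d b) = 0
  d_mul : ∀ ⦃i j : ℤ⦄ ⦃a b : B⦄, a ∈ ℬ i → b ∈ ℬ j →
    d (a * b) = d a * b + sgn i • (a * d b)

/-- `f` is a DG algebra map: a degree-`0` algebra map commuting with the differentials. -/
structure IsDGAlgebraMap (k : Type) [Field k] {A B : Type} [Ring A] [Algebra k A]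
    [Ring B] [Algebra k B] (𝒜 : ℤ → Submodule k A) (ℬ : ℤ → Submodule k B)
    (dA : A →ₗ[k] A) (dB : B →ₗ[k] B) (f : A →ₐ[k] B) : Prop where
  map_mem : ∀ ⦃i : ℤ⦄ ⦃a : A⦄, a ∈ 𝒜 i → f a ∈ ℬ i
  map_d : ∀ a : A, f (dA a) = dB (f a)

/-- The compatibility conditions satisfied by a pair `(f, g)` from a DG Poisson algebra
`A` to a DG algebra `B`: `f` is a DG algebra map, `g` is a degree-`0` `k`-linear map
commuting with the differentials which is a graded Lie algebra map into `B` with the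
graded commutator, and the two mixed identities hold. -/
def UEACompat (k : Type) [Field k] {A B : Type} [Ring A] [Algebra k A]
    [Ring B] [Algebra k B] (𝒜 : ℤ → Submodule k A) (ℬ : ℤ → Submodule k B)
    (P : DGPoissonAlgebra k A 𝒜) (dB : B →ₗ[k] B)
    (f : A →ₐ[k] B) (g : A →ₗ[k] B) : Prop :=
  IsDGAlgebraMap k 𝒜 ℬ P.d dB f ∧
  (∀ ⦃i : ℤ⦄ ⦃a : A⦄, a ∈ 𝒜 i → g a ∈ ℬ i) ∧
  (∀ a : A, g (P.d a) = dB (g a)) ∧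
  (∀ ⦃i j : ℤ⦄ ⦃a b : A⦄, a ∈ 𝒜 i → b ∈ 𝒜 j →
    g (P.br a b) = g a * g b - sgn (i * j) • (g b * g a)) ∧
  (∀ ⦃i j : ℤ⦄ ⦃a b : A⦄, a ∈ 𝒜 i → b ∈ 𝒜 j →
    f (P.br a b) = g a * f b - sgn (i * j) • (f b * g a)) ∧
  (∀ ⦃i j : ℤ⦄ ⦃a b : A⦄, a ∈ 𝒜 i → b ∈ 𝒜 j →
    g (a * b) = f a * g b + sgn (i * j) • (f b * g a))

/-- `(E, α, β)` is a universal enveloping algebra of the DG Poisson algebra `A`. -/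
def IsUEA (k : Type) [Field k] {A E : Type} [Ring A] [Algebra k A] [Ring E] [Algebra k E]
    (𝒜 : ℤ → Submodule k A) (ℰ : ℤ → Submodule k E)
    (P : DGPoissonAlgebra k A 𝒜) (DE : DGAlgebra k E ℰ)
    (α : A →ₐ[k] E) (β : A →ₗ[k] E) : Prop :=
  UEACompat k 𝒜 ℰ P DE.d α β ∧
  ∀ (D : Type) [Ring D] [Algebra k D] (𝒟 : ℤ → Submodule k D) [GradedAlgebra 𝒟]
    (dD : DGAlgebra k D 𝒟) (f : A →ₐ[k] D) (g : A →ₗ[k] D),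
    UEACompat k 𝒜 𝒟 P dD.d f g →
    ∃! φ : E →ₐ[k] D, IsDGAlgebraMap k ℰ 𝒟 DE.d dD.d φ ∧
      φ.comp α = f ∧ φ.toLinearMap.comp β = g

/-- The two-sided ideal of `F` generated by a set `S`, as a `k`-submodule. -/
def idealGen (k : Type) [Field k] {F : Type} [Ring F] [Algebra k F] (S : Set F) :
    Submodule k F :=
  Submodule.span k {z : F | ∃ u v : F, ∃ s ∈ S, z = u * s * v}

/-- The left ideal of `F` generated by a set `S`, as a `k`-submodule. -/
def leftIdealGen (k : Type) [Field k] {F : Type} [Ring F] [Algebra k F] (S : Set F) :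
    Submodule k F :=
  Submodule.span k {z : F | ∃ u : F, ∃ s ∈ S, z = u * s}

/-- A submodule is graded if it is spanned by its homogeneous elements. -/
def IsGradedSubmodule (k : Type) [Field k] {A : Type} [AddCommGroup A] [Module k A]
    (𝒜 : ℤ → Submodule k A) (M : Submodule k A) : Prop :=
  M ≤ Submodule.span k {a : A | a ∈ M ∧ ∃ i, a ∈ 𝒜 i}

/-- A `k`-submodule which is a two-sided ideal. -/
def IsTwoSidedIdealSub (k : Type) [Field k] {A : Type} [Ring A] [Algebra k A]
    (M : Submodule k A) : Prop :=
  ∀ r : A, ∀ m ∈ M, r * m ∈ M ∧ m * r ∈ M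

/-- A DG ideal: a graded two-sided ideal closed under the differential `d`. -/
def IsDGIdeal (k : Type) [Field k] {A : Type} [Ring A] [Algebra k A]
    (𝒜 : ℤ → Submodule k A) (d : A →ₗ[k] A) (M : Submodule k A) : Prop :=
  IsTwoSidedIdealSub k M ∧ IsGradedSubmodule k 𝒜 M ∧ ∀ m ∈ M, d m ∈ M

/-- A DG Poisson ideal: a DG ideal which is also closed under the Poisson bracket. -/
def IsDGPoissonIdeal (k : Type) [Field k] {A : Type} [Ring A] [Algebra k A]
    (𝒜 : ℤ → Submodule k A) (P : DGPoissonAlgebra k A 𝒜) (M : Submodule k A) : Prop :=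
  IsDGIdeal k 𝒜 P.d M ∧ ∀ a : A, ∀ m ∈ M, P.br a m ∈ M

/-- `π : A → B` presents `B` as the quotient of `A` by `I`. -/
structure IsQuotientBy (k : Type) [Field k] {A B : Type} [Ring A] [Algebra k A]
    [Ring B] [Algebra k B] (π : A →ₐ[k] B) (I : Submodule k A) : Prop where
  surj : Function.Surjective π
  ker : ∀ a : A, π a = 0 ↔ a ∈ I

/-- The (noncommutative, ordered) monomial `x 0 ^ e 0 * x 1 ^ e 1 * ⋯` . -/
def xMono {n : ℕ} {R : Type} [Ring R] (x : Fin n → R) (e : Fin n → ℕ) : R :=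
  ((List.finRange n).map fun r => x r ^ e r).prod
lemma sgn_add (i j : ℤ) : sgn (i + j) = sgn i * sgn j := by
  simp [sgn, Int.negOnePow_add]

lemma sgn_one : sgn 1 = -1 := by
  simp [sgn]

lemma sgn_eq_or (i : ℤ) : sgn i = 1 ∨ sgn i = -1 := by
  rcases Int.even_or_odd i with h | h
  · simp [sgn, Int.negOnePow_even i h]
  · simp [sgn, Int.negOnePow_odd i h]

section HomogeneousExt

variable {k A : Type} [Field k] [AddCommGroup A] [Module k A] (𝒜 : ℤ → Submodule k A)
  [DirectSum.Decomposition 𝒜]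

lemma linearMap_ext_homogeneous {M : Type} [AddCommGroup M] [Module k M] {f g : A →ₗ[k] M}
    (h : ∀ ⦃i : ℤ⦄ ⦃a : A⦄, a ∈ 𝒜 i → f a = g a) : f = g := by
  ext a
  induction a using DirectSum.Decomposition.inductionOn 𝒜 with
  | zero => simp
  | homogeneous m => exact h m.2
  | add m m' hm hm' => simp [hm, hm']

end HomogeneousExt

namespace AddMonoidAlgebra

variable (k S : Type) [Field k] [Ring S] [Algebra k S]

/-- The degree `i` component of the group algebra `S[ℤ]`, as a `k`-submodule. -/
def homogeneousPart (i : ℤ) : Submodule k (AddMonoidAlgebra S ℤ) :=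
  LinearMap.range (lsingle (R := k) (S := S) i)

variable {k S}

lemma single_mem_homogeneousPart (i : ℤ) (u : S) :
    (single i u : AddMonoidAlgebra S ℤ) ∈ homogeneousPart k S i :=
  ⟨u, rfl⟩

/-- The linear map on `S[ℤ]` given on each homogeneous component by `T i`. -/
def liftLinear {M : Type} [AddCommMonoid M] [Module k M] (T : ℤ → S →ₗ[k] M) :
    AddMonoidAlgebra S ℤ →ₗ[k] M :=
  (Finsupp.lsum k T).comp (coeffLinearEquiv k).toLinearMap

@[simp]
lemma liftLinear_single {M : Type} [AddCommMonoid M] [Module k M] (T : ℤ → S →ₗ[k] M)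
    (i : ℤ) (u : S) : liftLinear T (single i u) = T i u := by
  simp [liftLinear, -LaurentPolynomial.single_eq_C_mul_T]

instance homogeneousPart.gradedMonoid : SetLike.GradedMonoid (homogeneousPart k S) where
  one_mem := single_mem_homogeneousPart 0 1
  mul_mem := by
    rintro i j _ _ ⟨u, rfl⟩ ⟨v, rfl⟩
    rw [lsingle_apply, lsingle_apply, single_mul_single]
    exact single_mem_homogeneousPart _ _

instance homogeneousPart.decomposition : DirectSum.Decomposition (homogeneousPart k S) :=
  .ofLinearMap (homogeneousPart k S)
    (liftLinear (k := k) fun i => (DirectSum.lof k ℤ (fun i => homogeneousPart k S i) i).comp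
      (lsingle (R := k) (S := S) i).rangeRestrict)
    (by
      refine lhom_ext' fun i => LinearMap.ext fun u => ?_
      simp only [LinearMap.comp_apply, lsingle_apply, liftLinear_single, LinearMap.id_apply]
      exact DirectSum.coeLinearMap_lof (homogeneousPart k S) i ⟨_, u, rfl⟩)
    (by
      refine DirectSum.linearMap_ext _ fun i => LinearMap.ext ?_
      rintro ⟨_, u, rfl⟩
      simp [DirectSum.coeLinearMap_lof, -LaurentPolynomial.single_eq_C_mul_T]
      rfl)

instance homogeneousPart.gradedAlgebra : GradedAlgebra (homogeneousPart k S) where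

/-- The differential on `S[ℤ]` given by the graded commutator with an element `d` of degree `1`. -/
def commutatorDifferential (d : S) : AddMonoidAlgebra S ℤ →ₗ[k] AddMonoidAlgebra S ℤ :=
  liftLinear fun i => (lsingle (i + 1)).comp
    (LinearMap.mulLeft k d - sgn i • LinearMap.mulRight k d)

@[simp]
lemma commutatorDifferential_single (d : S) (i : ℤ) (u : S) :
    commutatorDifferential (k := k) d (single i u) = single (i + 1) (d * u - sgn i • (u * d)) := by
  simp [commutatorDifferential, -zsmul_eq_mul, -LaurentPolynomial.single_eq_C_mul_T]

/-- If `d ^ 2 = 0`, then the graded commutator with `d` makes `S[ℤ]` a DG algebra. -/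
def commutatorDGAlgebra (d : S) (hd : d * d = 0) :
    DGAlgebra k (AddMonoidAlgebra S ℤ) (homogeneousPart k S) where
  d := commutatorDifferential d
  d_mem := by
    rintro i _ ⟨u, rfl⟩
    rw [lsingle_apply, commutatorDifferential_single]
    exact single_mem_homogeneousPart _ _
  d_sq b := by
    refine LinearMap.congr_fun (f := (commutatorDifferential (k := k) d).comp
      (commutatorDifferential d)) (g := 0) ?_ b
    refine lhom_ext' fun i => LinearMap.ext fun u => ?_
    have h : ∀ v : S, d * (d * v) = 0 := fun v => by rw [← mul_assoc, hd, zero_mul]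
    rcases sgn_eq_or i with hi | hi <;>
      simp [sgn_add, sgn_one, hi, mul_assoc, hd, h,
        -LaurentPolynomial.single_eq_C_mul_T]
  d_mul := by
    rintro i j _ _ ⟨u, rfl⟩ ⟨v, rfl⟩
    simp only [lsingle_apply, commutatorDifferential_single, single_mul_single, smul_single]
    rw [show i + (j + 1) = i + j + 1 by ring, show i + 1 + j = i + j + 1 by ring, ← single_add]
    congr 1
    rcases sgn_eq_or i with hi | hi <;> rcases sgn_eq_or j with hj | hj <;>
      simp [sgn_add, hi, hj, mul_sub, sub_mul, mul_add, add_mul, mul_assoc] <;> abel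

end AddMonoidAlgebra

open AddMonoidAlgebra

section Homogenize

variable {k A S : Type} [Field k] [AddCommGroup A] [Module k A] [Ring S] [Algebra k S]
  (𝒜 : ℤ → Submodule k A) [DirectSum.Decomposition 𝒜]

/-- The degree-preserving map `A → S[ℤ]` which sends `a` of degree `i` to `L a` in degree `i`. -/
def homogenize (L : A →ₗ[k] S) : A →ₗ[k] AddMonoidAlgebra S ℤ :=
  (DirectSum.toModule k ℤ _ fun i => ((lsingle i).comp L).comp (𝒜 i).subtype).comp
    (DirectSum.decomposeLinearEquiv 𝒜).toLinearMap

lemma homogenize_of_mem (L : A →ₗ[k] S) {i : ℤ} {a : A} (ha : a ∈ 𝒜 i) :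
    homogenize 𝒜 L a = single i (L a) := by
  lift a to 𝒜 i using ha
  simp [homogenize]

end Homogenize

namespace DGPoissonAlgebra

variable {k A : Type} [Field k] [Ring A] [Algebra k A] {𝒜 : ℤ → Submodule k A}
  [GradedAlgebra 𝒜]

variable (𝒜) in
/-- Left multiplication, as a degree-preserving algebra map `A → (End A)[ℤ]`. -/
def gradedMul : A →ₐ[k] AddMonoidAlgebra (Module.End k A) ℤ :=
  AlgHom.ofLinearMap (homogenize 𝒜 (LinearMap.mul k A))
    (by
      rw [homogenize_of_mem 𝒜 _ (SetLike.GradedOne.one_mem (A := 𝒜)), one_def]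
      congr 1
      ext
      simp)
    (fun a b => by
      let F := homogenize 𝒜 (LinearMap.mul k A)
      have h : (LinearMap.mul k A).compr₂ F = (LinearMap.mul k _).compl₁₂ F F := by
        refine linearMap_ext_homogeneous 𝒜 fun i a ha => ?_
        refine linearMap_ext_homogeneous 𝒜 fun j b hb => ?_
        simp only [LinearMap.compr₂_apply, LinearMap.compl₁₂_apply, LinearMap.mul_apply', F,
          homogenize_of_mem 𝒜 _ ha, homogenize_of_mem 𝒜 _ hb,
          homogenize_of_mem 𝒜 _ (SetLike.GradedMul.mul_mem ha hb), single_mul_single]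
        congr 1
        ext c
        simp [mul_assoc]
      exact LinearMap.congr_fun₂ h a b)

lemma gradedMul_of_mem {i : ℤ} {a : A} (ha : a ∈ 𝒜 i) :
    gradedMul 𝒜 a = single i (LinearMap.mul k A a) :=
  homogenize_of_mem 𝒜 _ ha

variable (𝒜) in
lemma gradedMul_injective : Function.Injective (gradedMul (k := k) 𝒜) := by
  let ev : AddMonoidAlgebra (Module.End k A) ℤ →ₗ[k] A := liftLinear fun _ => LinearMap.applyₗ 1
  have h : ev.comp (gradedMul 𝒜).toLinearMap = .id :=
    linearMap_ext_homogeneous 𝒜 fun i a ha => by simp [ev, gradedMul_of_mem ha, -LaurentPolynomial.single_eq_C_mul_T]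
  exact Function.LeftInverse.injective (g := ev) (LinearMap.congr_fun h)

variable (P : DGPoissonAlgebra k A 𝒜)

lemma br_mul_left {i j l : ℤ} {a b c : A} (ha : a ∈ 𝒜 i) (hb : b ∈ 𝒜 j) (hc : c ∈ 𝒜 l) :
    P.br (a * b) c = a * P.br b c + sgn (i * j) • (b * P.br a c) := by
  rw [P.antisymm (SetLike.GradedMul.mul_mem ha hb) hc, P.leibniz hc ha hb, P.antisymm hc ha,
    P.antisymm hc hb, neg_mul, smul_mul_assoc, P.gcomm (P.br_mem ha hc) hb]
  simp only [add_mul, sgn_add, mul_comm l i, mul_comm l j]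
  rcases sgn_eq_or (i * l) with h₁ | h₁ <;> rcases sgn_eq_or (j * l) with h₂ | h₂ <;>
    rcases sgn_eq_or (i * j) with h₃ | h₃ <;>
    simp [h₁, h₂, h₃, add_comm]

/-- Left multiplications and Hamiltonian derivations satisfy the defining relations of the
universal enveloping algebra. -/
lemma uEACompat_gradedMul :
    UEACompat k 𝒜 (homogeneousPart k (Module.End k A)) P
      (commutatorDGAlgebra (P.d : Module.End k A) (LinearMap.ext P.d_sq)).d
      (gradedMul 𝒜) (homogenize 𝒜 (P.br : A →ₗ[k] Module.End k A)) := by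
  refine ⟨⟨fun i a ha => ?_, fun a => ?_⟩, fun i a ha => ?_, fun a => ?_,
    fun i j a b ha hb => ?_, fun i j a b ha hb => ?_, fun i j a b ha hb => ?_⟩
  · rw [gradedMul_of_mem ha]
    exact single_mem_homogeneousPart _ _
  · suffices h : (gradedMul 𝒜).toLinearMap.comp P.d =
        (commutatorDifferential (k := k) (P.d : Module.End k A)).comp
          (gradedMul 𝒜).toLinearMap from
      LinearMap.congr_fun h a
    refine linearMap_ext_homogeneous (M := AddMonoidAlgebra (Module.End k A) ℤ) 𝒜
      fun i a ha => ?_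
    simp only [LinearMap.comp_apply, AlgHom.toLinearMap_apply, gradedMul_of_mem ha,
      gradedMul_of_mem (P.d_mem ha), commutatorDifferential_single]
    congr 1
    refine linearMap_ext_homogeneous 𝒜 fun l c hc => ?_
    simp [P.d_mul ha hc]
  · rw [homogenize_of_mem 𝒜 _ ha]
    exact single_mem_homogeneousPart _ _
  · let G := homogenize 𝒜 (P.br : A →ₗ[k] Module.End k A)
    suffices h : G.comp P.d =
        (commutatorDifferential (k := k) (P.d : Module.End k A)).comp G from
      LinearMap.congr_fun h a
    refine linearMap_ext_homogeneous 𝒜 fun i a ha => ?_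
    simp only [LinearMap.comp_apply, G, homogenize_of_mem 𝒜 _ ha,
      homogenize_of_mem 𝒜 _ (P.d_mem ha), commutatorDifferential_single]
    congr 1
    refine linearMap_ext_homogeneous 𝒜 fun l c hc => ?_
    simp [P.d_br ha hc]
  · rw [homogenize_of_mem 𝒜 _ ha, homogenize_of_mem 𝒜 _ hb,
      homogenize_of_mem 𝒜 _ (P.br_mem ha hb), single_mul_single, single_mul_single,
      add_comm j i, smul_single, ← single_sub]
    congr 1
    refine linearMap_ext_homogeneous 𝒜 fun l c hc => ?_
    simp [P.jacobi ha hb hc]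
  · rw [homogenize_of_mem 𝒜 _ ha, gradedMul_of_mem hb, gradedMul_of_mem (P.br_mem ha hb),
      single_mul_single, single_mul_single, add_comm j i, smul_single, ← single_sub]
    congr 1
    refine linearMap_ext_homogeneous 𝒜 fun l c hc => ?_
    simp [P.leibniz ha hb hc]
  · rw [homogenize_of_mem 𝒜 _ ha, homogenize_of_mem 𝒜 _ hb, gradedMul_of_mem ha,
      gradedMul_of_mem hb, homogenize_of_mem 𝒜 _ (SetLike.GradedMul.mul_mem ha hb),
      single_mul_single, single_mul_single, add_comm j i, smul_single, ← single_add]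
    congr 1
    refine linearMap_ext_homogeneous 𝒜 fun l c hc => ?_
    simp [P.br_mul_left ha hb hc]

end DGPoissonAlgebra

/-- If `A` is a finitely generated DG Poisson algebra and
`(E, α, β)` is a universal enveloping algebra of `A`, then `α` is injective. -/
theorem stmt0 (k A E : Type) [Field k] [Ring A] [Algebra k A] [Ring E] [Algebra k E]
    (𝒜 : ℤ → Submodule k A) [GradedAlgebra 𝒜]
    (ℰ : ℤ → Submodule k E) [GradedAlgebra ℰ]
    (P : DGPoissonAlgebra k A 𝒜)
    (hfg : ∃ s : Finset A, Algebra.adjoin k (s : Set A) = ⊤)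
    (DE : DGAlgebra k E ℰ) (α : A →ₐ[k] E) (β : A →ₗ[k] E)
    (hU : IsUEA k 𝒜 ℰ P DE α β) :
    Function.Injective α := by
  obtain ⟨φ, ⟨-, hφ, -⟩, -⟩ := hU.2 _ _ _ _ _ P.uEACompat_gradedMul
  refine Function.Injective.of_comp (f := φ) ?_
  rw [← AlgHom.coe_comp, hφ]
  exact DGPoissonAlgebra.gradedMul_injective 𝒜
end
end

section
/- Assume that either char k = 2 or every |x_i| is even, so that the monomials x_1^{i_1} ... x_n^{i_n} form a k-basis of R. For a DG ideal I of R (a graded ideal with d(I) ⊆ I), let Ī denote the left ideal of R^e generated by m_R(I). Then m_R^{-1}(Ī) = I; consequently the assignment I ↦ Ī is an injective, inclusion-preserving map from the set of DG ideals of R to the set of left DG ideals of R^e. Moreover, I is a DG Poisson ideal of R (i.e. additionally {R, I} ⊆ I) if and only if Ī is a two-sided ideal of R^e closed under the differential of R^e. -/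
noncomputable section

open scoped DirectSum

section Signs

lemma sgn_eq_one_or_neg_one (m : ℤ) : sgn m = 1 ∨ sgn m = -1 := by
  rcases Int.units_eq_one_or (Int.negOnePow m) with h | h <;> simp [sgn, h]

lemma sgn_of_even {m : ℤ} (h : Even m) : sgn m = 1 := by
  simp [sgn, Int.negOnePow_even m h]

lemma sgn_smul_sgn_smul {V : Type} [AddCommGroup V] (m : ℤ) (z : V) :
    sgn m • sgn m • z = z := by
  rcases sgn_eq_one_or_neg_one m with h | h <;> simp [h]

/-- Every Koszul sign is invisible for a grading `𝒜` over `k`: either `2 = 0` in `k`, or `𝒜` is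
concentrated in even degrees. -/
def SignTrivial (k : Type) [Field k] {A : Type} [AddCommGroup A] [Module k A]
    (𝒜 : ℤ → Submodule k A) : Prop :=
  (2 : k) = 0 ∨ ∀ i, Odd i → 𝒜 i = ⊥

lemma neg_eq_self_of_two_eq_zero {k : Type} [Field k] (h : (2 : k) = 0) {V : Type}
    [AddCommGroup V] [Module k V] (z : V) : -z = z := by
  rw [neg_eq_iff_add_eq_zero, ← two_smul k z, h, zero_smul]

lemma sgn_smul_of_two_eq_zero {k : Type} [Field k] (h : (2 : k) = 0) {V : Type}
    [AddCommGroup V] [Module k V] (m : ℤ) (z : V) : sgn m • z = z := by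
  rcases sgn_eq_one_or_neg_one m with hm | hm <;> simp [hm, neg_eq_self_of_two_eq_zero h]

lemma SignTrivial.eq_zero_or {k : Type} [Field k] {A : Type} [AddCommGroup A] [Module k A]
    {𝒜 : ℤ → Submodule k A} (hs : SignTrivial k 𝒜) {i : ℤ} {a : A} (ha : a ∈ 𝒜 i) :
    a = 0 ∨ ∀ {V : Type} [AddCommGroup V] [Module k V] (z : V),
      sgn i • z = z ∧ ∀ j, sgn (i * j) • z = z := by
  rcases hs with h | h
  · exact .inr fun z => ⟨sgn_smul_of_two_eq_zero h _ z, fun _ => sgn_smul_of_two_eq_zero h _ z⟩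
  · rcases Int.even_or_odd i with hi | hi
    · exact .inr fun z => ⟨by simp [sgn_of_even hi],
        fun j => by simp [sgn_of_even (hi.mul_right j)]⟩
    · exact .inl (by simpa [h i hi] using ha)

end Signs

section Graded

variable {k A : Type} [Field k] [Ring A] [Algebra k A]

lemma isInternal_of_projections {V : Type} [AddCommGroup V] [Module k V]
    (ℳ : ℤ → Submodule k V) (π : ℤ → V →ₗ[k] V)
    (hsame : ∀ i, ∀ v ∈ ℳ i, π i v = v) (hne : ∀ i j, j ≠ i → ∀ v ∈ ℳ j, π i v = 0)
    (htop : ∀ v, v ∈ ⨆ i, ℳ i) : DirectSum.IsInternal ℳ := by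
  rw [DirectSum.isInternal_submodule_iff_iSupIndep_and_iSup_eq_top]
  refine ⟨fun i => ?_, eq_top_iff.2 fun v _ => htop v⟩
  rw [Submodule.disjoint_def]
  intro v hv hv'
  have hker : (⨆ j, ⨆ _ : j ≠ i, ℳ j) ≤ LinearMap.ker (π i) :=
    iSup₂_le fun j hj v hv => hne i j hj v hv
  rw [← hsame i v hv]
  exact hker hv'

lemma IsGradedSubmodule.induction {𝒜 : ℤ → Submodule k A} {M : Submodule k A}
    (hM : IsGradedSubmodule k 𝒜 M) {N : Submodule k A} (h : ∀ i, ∀ m ∈ M, m ∈ 𝒜 i → m ∈ N) :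
    M ≤ N :=
  hM.trans (Submodule.span_le.2 fun m ⟨hm, i, hi⟩ => h i m hm hi)

variable (𝒜 : ℤ → Submodule k A) [GradedAlgebra 𝒜]

lemma sum_proj (a : A) :
    ∃ s : Finset ℤ, a = ∑ i ∈ s, GradedAlgebra.proj 𝒜 i a := by
  classical
  exact ⟨_, (DirectSum.sum_support_decompose 𝒜 a).symm⟩

lemma proj_mem (i : ℤ) (a : A) : GradedAlgebra.proj 𝒜 i a ∈ 𝒜 i := by simp

lemma proj_same {i : ℤ} {a : A} (ha : a ∈ 𝒜 i) : GradedAlgebra.proj 𝒜 i a = a := by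
  simpa using DirectSum.decompose_of_mem_same 𝒜 ha

lemma proj_ne {i j : ℤ} {a : A} (ha : a ∈ 𝒜 i) (h : i ≠ j) : GradedAlgebra.proj 𝒜 j a = 0 := by
  simpa using DirectSum.decompose_of_mem_ne 𝒜 ha h

lemma homogeneous_induction {p : A → Prop} (hp : ∀ i, ∀ a ∈ 𝒜 i, p a)
    (h0 : p 0) (hadd : ∀ a b, p a → p b → p (a + b)) (a : A) : p a :=
  DirectSum.Decomposition.inductionOn 𝒜 h0 (fun m => hp _ _ m.2) hadd a

lemma linearMap_eq_of_homogeneous {V : Type} [AddCommGroup V] [Module k V] {f g : A →ₗ[k] V}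
    (h : ∀ i, ∀ a ∈ 𝒜 i, f a = g a) (a : A) : f a = g a :=
  homogeneous_induction 𝒜 h (by simp) (fun a b ha hb => by simp [ha, hb]) a

variable {𝒜}

lemma IsGradedSubmodule.proj_mem {M : Submodule k A} (hM : IsGradedSubmodule k 𝒜 M) {m : A}
    (hm : m ∈ M) (i : ℤ) : GradedAlgebra.proj 𝒜 i m ∈ M := by
  suffices Submodule.span k {a : A | a ∈ M ∧ ∃ i, a ∈ 𝒜 i} ≤ M.comap (GradedAlgebra.proj 𝒜 i) from
    this (hM hm)
  rw [Submodule.span_le]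
  rintro a ⟨ha, j, haj⟩
  change GradedAlgebra.proj 𝒜 i a ∈ M
  by_cases h : j = i
  · subst h; rwa [proj_same 𝒜 haj]
  · rw [proj_ne 𝒜 haj h]; exact M.zero_mem

/-- A subalgebra containing all homogeneous components of its elements is graded. -/
abbrev gradedSubalgebra (B : Subalgebra k A) (hB : ∀ b ∈ B, ∀ i, GradedAlgebra.proj 𝒜 i b ∈ B) :
    GradedAlgebra fun i => (𝒜 i).comap B.val.toLinearMap :=
  { one_mem := SetLike.one_mem_graded 𝒜
    mul_mem := fun _ _ _ _ ha hb => SetLike.mul_mem_graded (A := 𝒜) ha hb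
    toDecomposition := DirectSum.IsInternal.chooseDecomposition _ <|
      isInternal_of_projections _
        (fun i => (GradedAlgebra.proj 𝒜 i).restrict
          (p := Subalgebra.toSubmodule B) (q := Subalgebra.toSubmodule B) fun b hb => hB b hb i)
        (fun _ _ hv => Subtype.ext (proj_same 𝒜 hv))
        (fun _ _ hij _ hv => Subtype.ext (proj_ne 𝒜 hv hij))
        (fun v => by
          obtain ⟨s, hs⟩ := sum_proj 𝒜 (v : A)
          have : v = ∑ i ∈ s, (⟨_, hB v v.2 i⟩ : B) := Subtype.ext (by simpa using hs)
          rw [this]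
          exact Submodule.sum_mem _ fun i _ =>
            Submodule.mem_iSup_of_mem i (_root_.proj_mem 𝒜 i (v : A))) }

end Graded

section Laurent

variable (k S : Type) [Field k] [Ring S] [Algebra k S]

/-- The grading of the Laurent polynomial algebra `S[T, T⁻¹]` by the exponent of `T`. -/
def laurentGrading (i : ℤ) : Submodule k (AddMonoidAlgebra S ℤ) :=
  LinearMap.range (AddMonoidAlgebra.lsingle i : S →ₗ[k] AddMonoidAlgebra S ℤ)

instance : GradedAlgebra (laurentGrading k S) :=
  { one_mem := ⟨1, rfl⟩
    mul_mem := by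
      rintro i j _ _ ⟨a, rfl⟩ ⟨b, rfl⟩
      exact ⟨a * b, by simp [-LaurentPolynomial.single_eq_C_mul_T]⟩
    toDecomposition := DirectSum.IsInternal.chooseDecomposition _ <|
      isInternal_of_projections _
        (fun i => AddMonoidAlgebra.lsingle i ∘ₗ Finsupp.lapply i ∘ₗ
          (AddMonoidAlgebra.coeffLinearEquiv k).toLinearMap)
        (by rintro i _ ⟨a, rfl⟩; simp [-LaurentPolynomial.single_eq_C_mul_T])
        (by rintro i j h _ ⟨a, rfl⟩; simp [-LaurentPolynomial.single_eq_C_mul_T, h.symm])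
        (fun v => AddMonoidAlgebra.induction_linear v (Submodule.zero_mem _)
          (fun _ _ => Submodule.add_mem _)
          (fun i s => Submodule.mem_iSup_of_mem i ⟨s, rfl⟩)) }

variable {k S}

lemma single_mem_laurentGrading (i : ℤ) (s : S) :
    AddMonoidAlgebra.single i s ∈ laurentGrading k S i := ⟨s, rfl⟩

/-- The evaluation `T ↦ 1`. -/
def laurentEval : AddMonoidAlgebra S ℤ →ₐ[k] S :=
  AddMonoidAlgebra.liftNCAlgHom (AlgHom.id k S) 1 fun x _ => Commute.one_right x

lemma laurentEval_single (i : ℤ) (s : S) :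
    laurentEval (k := k) (AddMonoidAlgebra.single i s) = s :=
  (AddMonoidAlgebra.liftNC_single _ _ _ _).trans (by simp)

/-- The degree-one map `s Tⁱ ↦ δ(s) Tⁱ⁺¹`. -/
def laurentShift (δ : S →ₗ[k] S) : AddMonoidAlgebra S ℤ →ₗ[k] AddMonoidAlgebra S ℤ :=
  Finsupp.lsum k (fun i => AddMonoidAlgebra.lsingle (i + 1) ∘ₗ δ) ∘ₗ
    (AddMonoidAlgebra.coeffLinearEquiv k).toLinearMap

lemma laurentShift_single (δ : S →ₗ[k] S) (i : ℤ) (s : S) :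
    laurentShift δ (AddMonoidAlgebra.single i s) = AddMonoidAlgebra.single (i + 1) (δ s) := by
  simp [laurentShift, -LaurentPolynomial.single_eq_C_mul_T]

variable {R : Type} [Ring R] [Algebra k R] (𝒜 : ℤ → Submodule k R) [GradedAlgebra 𝒜]

/-- The degree-zero map sending `a` of degree `i` to `F(a) Tⁱ`. -/
def laurentLift (F : R →ₗ[k] S) : R →ₗ[k] AddMonoidAlgebra S ℤ :=
  DirectSum.toModule k ℤ _ (fun i => AddMonoidAlgebra.lsingle i ∘ₗ F ∘ₗ (𝒜 i).subtype) ∘ₗ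
    (DirectSum.decomposeLinearEquiv 𝒜).toLinearMap

lemma laurentLift_of_mem (F : R →ₗ[k] S) {i : ℤ} {a : R} (ha : a ∈ 𝒜 i) :
    laurentLift 𝒜 F a = AddMonoidAlgebra.single i (F a) := by
  lift a to 𝒜 i using ha
  simp only [laurentLift, LinearMap.comp_apply, LinearEquiv.coe_coe,
    DirectSum.decomposeLinearEquiv_apply_coe, DirectSum.toModule_lof]
  rfl

lemma laurentEval_laurentLift (F : R →ₗ[k] S) (a : R) :
    laurentEval (k := k) (laurentLift 𝒜 F a) = F a :=
  linearMap_eq_of_homogeneous 𝒜 (f := laurentEval.toLinearMap ∘ₗ laurentLift 𝒜 F) (g := F)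
    (fun i a ha => by
      simp [laurentLift_of_mem 𝒜 F ha, laurentEval_single, -LaurentPolynomial.single_eq_C_mul_T]) a

end Laurent

namespace DGPoissonAlgebra

variable {k R : Type} [Field k] [Ring R] [Algebra k R] {𝒜 : ℤ → Submodule k R}
  (P : DGPoissonAlgebra k R 𝒜)

/-- The commutator with the differential, as a map on the opposite of `Module.End k R`. -/
def endDifferential : (Module.End k R)ᵐᵒᵖ →ₗ[k] (Module.End k R)ᵐᵒᵖ :=
  LinearMap.mulRight k (MulOpposite.op P.d) - LinearMap.mulLeft k (MulOpposite.op P.d)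

lemma endDifferential_apply (s : (Module.End k R)ᵐᵒᵖ) :
    P.endDifferential s = s * MulOpposite.op P.d - MulOpposite.op P.d * s := rfl

/-- The right regular representation of `R`. -/
def rightMul : R →ₗ[k] (Module.End k R)ᵐᵒᵖ :=
  (MulOpposite.opLinearEquiv k).toLinearMap ∘ₗ (LinearMap.mul k R).flip

/-- The right action `s · a = -{a, s}` of the Lie algebra `R` on itself. -/
def rightAd : R →ₗ[k] (Module.End k R)ᵐᵒᵖ :=
  -((MulOpposite.opLinearEquiv k).toLinearMap ∘ₗ P.br)

@[simp]
lemma unop_rightMul_apply (a s : R) : (rightMul (k := k) a).unop s = s * a := rfl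

@[simp]
lemma unop_rightAd_apply (a s : R) : (P.rightAd a).unop s = -P.br a s := rfl

variable [GradedAlgebra 𝒜]

section SignTrivial

variable (hs : SignTrivial k 𝒜)

include hs

include P in
lemma mul_comm_of_signTrivial (a b : R) : a * b = b * a := by
  induction a using homogeneous_induction 𝒜 with
  | h0 => simp
  | hadd a a' ha ha' => simp [add_mul, mul_add, ha, ha']
  | hp i a ha =>
  induction b using homogeneous_induction 𝒜 with
  | h0 => simp
  | hadd b b' hb hb' => simp [add_mul, mul_add, hb, hb']
  | hp j b hb =>
  obtain rfl | h := hs.eq_zero_or ha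
  · simp
  · rw [P.gcomm ha hb, (h _).2]

lemma br_antisymm_of_signTrivial (a b : R) : P.br a b = -P.br b a := by
  induction a using homogeneous_induction 𝒜 with
  | h0 => simp
  | hadd a a' ha ha' => simp [ha, ha', add_comm]
  | hp i a ha =>
  induction b using homogeneous_induction 𝒜 with
  | h0 => simp
  | hadd b b' hb hb' => simp [hb, hb', add_comm]
  | hp j b hb =>
  obtain rfl | h := hs.eq_zero_or ha
  · simp
  · rw [P.antisymm ha hb, (h _).2]

lemma br_jacobi_of_signTrivial (a b c : R) :
    P.br a (P.br b c) = P.br (P.br a b) c + P.br b (P.br a c) := by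
  induction a using homogeneous_induction 𝒜 with
  | h0 => simp
  | hadd a a' ha ha' => simp only [map_add, LinearMap.add_apply, ha, ha']; abel
  | hp i a ha =>
  induction b using homogeneous_induction 𝒜 with
  | h0 => simp
  | hadd b b' hb hb' => simp only [map_add, LinearMap.add_apply, hb, hb']; abel
  | hp j b hb =>
  induction c using homogeneous_induction 𝒜 with
  | h0 => simp
  | hadd c c' hc hc' => simp only [map_add, hc, hc']; abel
  | hp l c hc =>
  obtain rfl | h := hs.eq_zero_or ha
  · simp
  · rw [P.jacobi ha hb hc, (h _).2]

lemma br_mul_of_signTrivial (a b c : R) : P.br a (b * c) = P.br a b * c + b * P.br a c := by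
  induction a using homogeneous_induction 𝒜 with
  | h0 => simp
  | hadd a a' ha ha' =>
    simp only [map_add, LinearMap.add_apply, add_mul, mul_add, ha, ha']; abel
  | hp i a ha =>
  induction b using homogeneous_induction 𝒜 with
  | h0 => simp
  | hadd b b' hb hb' => simp only [map_add, add_mul, hb, hb']; abel
  | hp j b hb =>
  induction c using homogeneous_induction 𝒜 with
  | h0 => simp
  | hadd c c' hc hc' => simp only [map_add, mul_add, hc, hc']; abel
  | hp l c hc =>
  obtain rfl | h := hs.eq_zero_or ha
  · simp
  · rw [P.leibniz ha hb hc, (h _).2]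

lemma d_br_of_signTrivial (a b : R) : P.d (P.br a b) = P.br (P.d a) b + P.br a (P.d b) := by
  induction a using homogeneous_induction 𝒜 with
  | h0 => simp
  | hadd a a' ha ha' => simp only [map_add, LinearMap.add_apply, ha, ha']; abel
  | hp i a ha =>
  induction b using homogeneous_induction 𝒜 with
  | h0 => simp
  | hadd b b' hb hb' => simp only [map_add, hb, hb']; abel
  | hp j b hb =>
  obtain rfl | h := hs.eq_zero_or ha
  · simp
  · rw [P.d_br ha hb, (h _).1]

lemma d_mul_of_signTrivial (a b : R) : P.d (a * b) = P.d a * b + a * P.d b := by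
  induction a using homogeneous_induction 𝒜 with
  | h0 => simp
  | hadd a a' ha ha' => simp only [map_add, add_mul, ha, ha']; abel
  | hp i a ha =>
  induction b using homogeneous_induction 𝒜 with
  | h0 => simp
  | hadd b b' hb hb' => simp only [map_add, mul_add, hb, hb']; abel
  | hp j b hb =>
  obtain rfl | h := hs.eq_zero_or ha
  · simp
  · rw [P.d_mul ha hb, (h _).1]

lemma two_eq_zero_or_d_eq_zero : (2 : k) = 0 ∨ P.d = 0 := by
  refine hs.imp id fun h => LinearMap.ext fun a =>
    linearMap_eq_of_homogeneous 𝒜 (g := 0) (fun i a ha => ?_) a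
  rcases Int.even_or_odd i with hi | hi
  · have := P.d_mem ha
    rw [h _ hi.add_one] at this
    simpa using this
  · rw [h i hi] at ha
    simp [(Submodule.mem_bot k).1 ha]

end SignTrivial

lemma unop_ext {s t : (Module.End k R)ᵐᵒᵖ} (h : ∀ r, s.unop r = t.unop r) : s = t :=
  MulOpposite.unop_injective (LinearMap.ext h)

lemma rightMul_one : rightMul (k := k) (1 : R) = 1 := unop_ext fun r => by simp

lemma rightMul_mul (a b : R) : rightMul (k := k) (a * b) = rightMul a * rightMul b :=
  unop_ext fun r => by simp [mul_assoc]

section SignTrivial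

variable (hs : SignTrivial k 𝒜)

include hs

lemma rightMul_d (a : R) : rightMul (P.d a) = P.endDifferential (rightMul a) :=
  unop_ext fun r => by
    simp [endDifferential_apply, P.d_mul_of_signTrivial hs]

lemma rightAd_d (a : R) : P.rightAd (P.d a) = P.endDifferential (P.rightAd a) :=
  unop_ext fun r => by
    simp [endDifferential_apply, P.d_br_of_signTrivial hs]

lemma rightAd_br (a b : R) :
    P.rightAd (P.br a b) = P.rightAd a * P.rightAd b - P.rightAd b * P.rightAd a :=
  unop_ext fun r => by
    simp [P.br_jacobi_of_signTrivial hs a b r]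

lemma rightMul_br (a b : R) :
    rightMul (P.br a b) = P.rightAd a * rightMul b - rightMul b * P.rightAd a :=
  unop_ext fun r => by
    simp [P.br_mul_of_signTrivial hs a r b]

lemma rightAd_mul (a b : R) :
    P.rightAd (a * b) = rightMul a * P.rightAd b + rightMul b * P.rightAd a :=
  unop_ext fun r => by
    have h := P.br_antisymm_of_signTrivial hs
    simp only [MulOpposite.unop_add, MulOpposite.unop_mul, LinearMap.add_apply,
      Module.End.mul_apply, unop_rightMul_apply, unop_rightAd_apply,
      P.br_mul_of_signTrivial hs]
    rw [h (a * b) r, P.br_mul_of_signTrivial hs, h r a, h r b, h b a,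
      P.mul_comm_of_signTrivial hs a (-P.br b r)]
    noncomm_ring

/-- `(Module.End k R)ᵐᵒᵖ[T, T⁻¹]` with the commutator differential. -/
def laurentEndDG : DGAlgebra k (AddMonoidAlgebra (Module.End k R)ᵐᵒᵖ ℤ)
    (laurentGrading k (Module.End k R)ᵐᵒᵖ) where
  d := laurentShift P.endDifferential
  d_mem := by
    rintro i _ ⟨s, rfl⟩
    exact ⟨_, (laurentShift_single _ _ _).symm⟩
  d_sq b := by
    suffices laurentShift P.endDifferential ∘ₗ laurentShift P.endDifferential = 0 from
      LinearMap.congr_fun this b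
    refine LinearMap.ext fun b => ?_
    induction b using AddMonoidAlgebra.induction_linear with
    | zero => simp
    | add b b' hb hb' => rw [map_add, hb, hb', map_add]
    | single i s =>
      have hd : MulOpposite.op P.d * MulOpposite.op P.d = 0 := unop_ext P.d_sq
      have key : P.endDifferential (P.endDifferential s) = 0 := by
        have : P.endDifferential (P.endDifferential s) =
            s * (MulOpposite.op P.d * MulOpposite.op P.d) +
              MulOpposite.op P.d * MulOpposite.op P.d * s -
              (2 : k) • (MulOpposite.op P.d * s * MulOpposite.op P.d) := by
          simp only [endDifferential_apply, two_smul, mul_sub, sub_mul, mul_assoc]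
          abel
        rw [this, hd]
        rcases P.two_eq_zero_or_d_eq_zero hs with h | h <;> simp [h]
      simp only [LinearMap.comp_apply, laurentShift_single, key, AddMonoidAlgebra.single_zero,
        LinearMap.zero_apply]
  d_mul := by
    rintro i j _ _ ⟨a, rfl⟩ ⟨b, rfl⟩
    change laurentShift _ (AddMonoidAlgebra.single i a * AddMonoidAlgebra.single j b) =
      laurentShift _ (AddMonoidAlgebra.single i a) * AddMonoidAlgebra.single j b +
        sgn i • (AddMonoidAlgebra.single i a * laurentShift _ (AddMonoidAlgebra.single j b))
    have key : sgn i • AddMonoidAlgebra.single (i + j + 1) (a * P.endDifferential b) =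
        AddMonoidAlgebra.single (i + j + 1) (a * P.endDifferential b) := by
      rcases P.two_eq_zero_or_d_eq_zero hs with h | h
      · exact sgn_smul_of_two_eq_zero (V := AddMonoidAlgebra (Module.End k R)ᵐᵒᵖ ℤ) h _ _
      · simp [endDifferential_apply, h]
    rw [AddMonoidAlgebra.single_mul_single, laurentShift_single, laurentShift_single,
      laurentShift_single, AddMonoidAlgebra.single_mul_single, AddMonoidAlgebra.single_mul_single,
      ← add_assoc i j 1, key, add_right_comm i 1 j, ← AddMonoidAlgebra.single_add]
    congr 1
    simp only [endDifferential_apply, mul_sub, sub_mul, mul_assoc]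
    abel

omit hs in
lemma exists_laurentRightMul : ∃ f : R →ₐ[k] AddMonoidAlgebra (Module.End k R)ᵐᵒᵖ ℤ,
    ∀ a, f a = laurentLift 𝒜 rightMul a := by
  refine ⟨AlgHom.ofLinearMap (laurentLift 𝒜 rightMul) ?_ ?_, fun _ => rfl⟩
  · rw [laurentLift_of_mem 𝒜 _ (SetLike.one_mem_graded 𝒜), rightMul_one]
    rfl
  · intro a b
    induction a using homogeneous_induction 𝒜 with
    | h0 => simp
    | hadd a a' ha ha' => simp only [map_add, add_mul, ha, ha']
    | hp i a ha =>
    induction b using homogeneous_induction 𝒜 with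
    | h0 => simp
    | hadd b b' hb hb' => simp only [map_add, mul_add, hb, hb']
    | hp j b hb =>
    rw [laurentLift_of_mem 𝒜 _ ha, laurentLift_of_mem 𝒜 _ hb,
      laurentLift_of_mem 𝒜 _ (SetLike.mul_mem_graded ha hb), rightMul_mul,
      AddMonoidAlgebra.single_mul_single]

lemma laurentLift_d {F : R →ₗ[k] (Module.End k R)ᵐᵒᵖ}
    (hF : ∀ a, F (P.d a) = P.endDifferential (F a)) (a : R) :
    laurentLift 𝒜 F (P.d a) = (P.laurentEndDG hs).d (laurentLift 𝒜 F a) :=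
  linearMap_eq_of_homogeneous 𝒜 (f := laurentLift 𝒜 F ∘ₗ P.d)
    (g := (P.laurentEndDG hs).d ∘ₗ laurentLift 𝒜 F)
    (fun i a ha => by
      simp only [LinearMap.comp_apply]
      rw [laurentLift_of_mem 𝒜 F ha, laurentLift_of_mem 𝒜 F (P.d_mem ha), hF]
      exact (laurentShift_single _ _ _).symm) a

/-- `R` is a right module over the enveloping algebra of `R`, with `1 ∈ R` generating the right
regular representation. -/
lemma exists_right_representation {E : Type} [Ring E] [Algebra k E] {ℰ : ℤ → Submodule k E}
    {DE : DGAlgebra k E ℰ} {mR : R →ₐ[k] E} {hR : R →ₗ[k] E} (hUEA : IsUEA k 𝒜 ℰ P DE mR hR) :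
    ∃ Φ : E →ₐ[k] (Module.End k R)ᵐᵒᵖ, ∀ a, Φ (mR a) = rightMul a := by
  obtain ⟨f, hf⟩ := exists_laurentRightMul (k := k) (𝒜 := 𝒜)
  have hsgn : ∀ {i j : ℤ} {a b : R}, a ∈ 𝒜 i → ∀ (F G : R →ₗ[k] (Module.End k R)ᵐᵒᵖ),
      sgn (i * j) • AddMonoidAlgebra.single (j + i) (F b * G a) =
        AddMonoidAlgebra.single (i + j) (F b * G a) := by
    intro i j a b ha F G
    rw [add_comm j]
    obtain rfl | h := hs.eq_zero_or ha
    · simp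
    · exact (h (V := AddMonoidAlgebra (Module.End k R)ᵐᵒᵖ ℤ) _).2 j
  obtain ⟨φ, ⟨-, hφ, -⟩, -⟩ := hUEA.2 _ _ (P.laurentEndDG hs) f (laurentLift 𝒜 P.rightAd) <| by
    refine ⟨⟨fun i a ha => ?_, fun a => ?_⟩, fun i a ha => ?_, ?_, fun i j a b ha hb => ?_,
      fun i j a b ha hb => ?_, fun i j a b ha hb => ?_⟩
    · rw [hf, laurentLift_of_mem 𝒜 _ ha]
      exact single_mem_laurentGrading _ _
    · rw [hf, hf]
      exact P.laurentLift_d hs (P.rightMul_d hs) a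
    · rw [laurentLift_of_mem 𝒜 _ ha]
      exact single_mem_laurentGrading _ _
    · exact P.laurentLift_d hs (P.rightAd_d hs)
    · rw [laurentLift_of_mem 𝒜 _ ha, laurentLift_of_mem 𝒜 _ hb,
        laurentLift_of_mem 𝒜 _ (P.br_mem ha hb), AddMonoidAlgebra.single_mul_single,
        AddMonoidAlgebra.single_mul_single, hsgn ha, ← AddMonoidAlgebra.single_sub,
        P.rightAd_br hs]
    · rw [hf, hf, laurentLift_of_mem 𝒜 _ ha, laurentLift_of_mem 𝒜 _ hb,
        laurentLift_of_mem 𝒜 _ (P.br_mem ha hb), AddMonoidAlgebra.single_mul_single,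
        AddMonoidAlgebra.single_mul_single, hsgn ha, ← AddMonoidAlgebra.single_sub,
        P.rightMul_br hs]
    · rw [hf, hf, laurentLift_of_mem 𝒜 rightMul ha, laurentLift_of_mem 𝒜 rightMul hb,
        laurentLift_of_mem 𝒜 _ ha, laurentLift_of_mem 𝒜 _ hb,
        laurentLift_of_mem 𝒜 _ (SetLike.mul_mem_graded ha hb), AddMonoidAlgebra.single_mul_single,
        AddMonoidAlgebra.single_mul_single, hsgn ha, ← AddMonoidAlgebra.single_add,
        P.rightAd_mul hs]
  refine ⟨laurentEval.comp φ, fun a => ?_⟩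
  rw [AlgHom.comp_apply, ← laurentEval_laurentLift 𝒜 rightMul a, ← hf, ← hφ, AlgHom.comp_apply]

end SignTrivial

end DGPoissonAlgebra

section LeftIdeal

variable {k R E : Type} [Field k] [Ring R] [Algebra k R] [Ring E] [Algebra k E]

lemma mul_mem_leftIdealGen {F : Type} [Ring F] [Algebra k F] {S : Set F} (u : F) {z : F}
    (hz : z ∈ leftIdealGen k S) : u * z ∈ leftIdealGen k S := by
  suffices leftIdealGen k S ≤ (leftIdealGen k S).comap (LinearMap.mulLeft k u) from this hz
  refine Submodule.span_le.2 ?_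
  rintro _ ⟨v, s, hs, rfl⟩
  exact Submodule.subset_span ⟨u * v, s, hs, (mul_assoc u v s).symm⟩

lemma subset_leftIdealGen {F : Type} [Ring F] [Algebra k F] (S : Set F) :
    S ⊆ leftIdealGen k S := fun s hs =>
  Submodule.subset_span ⟨1, s, hs, (one_mul s).symm⟩

lemma leftIdealGen_mono {F : Type} [Ring F] [Algebra k F] {S T : Set F} (h : S ⊆ T) :
    leftIdealGen k S ≤ leftIdealGen k T :=
  Submodule.span_mono fun _ ⟨u, s, hs, hz⟩ => ⟨u, s, h hs, hz⟩

variable {𝒜 : ℤ → Submodule k R} {ℰ : ℤ → Submodule k E} [GradedAlgebra ℰ] {mR : R →ₐ[k] E}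
  {I : Submodule k R}

variable (ℰ mR) in
/-- To bound the left ideal generated by a graded ideal it suffices to consider products of
homogeneous elements. -/
lemma leftIdealGen_image_le (hI : IsGradedSubmodule k 𝒜 I) {N : Submodule k E}
    (hN : ∀ i, ∀ u ∈ ℰ i, ∀ j, ∀ s ∈ I, s ∈ 𝒜 j → u * mR s ∈ N) :
    leftIdealGen k (mR '' (I : Set R)) ≤ N := by
  refine Submodule.span_le.2 ?_
  rintro _ ⟨u, _, ⟨s, hs, rfl⟩, rfl⟩
  change u * mR s ∈ N
  induction u using homogeneous_induction ℰ with
  | h0 => simp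
  | hadd u v hu hv => rw [add_mul]; exact N.add_mem hu hv
  | hp i u hu =>
    exact hI.induction (N := N.comap (LinearMap.mulLeft k u ∘ₗ mR.toLinearMap))
      (fun j s hs hsj => hN i u hu j s hs hsj) hs

lemma isGradedSubmodule_leftIdealGen (hI : IsGradedSubmodule k 𝒜 I)
    (hm : ∀ ⦃i a⦄, a ∈ 𝒜 i → mR a ∈ ℰ i) :
    IsGradedSubmodule k ℰ (leftIdealGen k (mR '' (I : Set R))) :=
  leftIdealGen_image_le ℰ mR hI fun i u hu j _ hs hsj =>
    Submodule.subset_span ⟨mul_mem_leftIdealGen u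
        (subset_leftIdealGen _ (Set.mem_image_of_mem mR hs)),
      i + j, SetLike.mul_mem_graded hu (hm hsj)⟩

lemma d_mem_leftIdealGen {P : DGPoissonAlgebra k R 𝒜} (hI : IsDGIdeal k 𝒜 P.d I)
    {DE : DGAlgebra k E ℰ} (hm : IsDGAlgebraMap k 𝒜 ℰ P.d DE.d mR) {z : E}
    (hz : z ∈ leftIdealGen k (mR '' (I : Set R))) :
    DE.d z ∈ leftIdealGen k (mR '' (I : Set R)) := by
  refine leftIdealGen_image_le ℰ mR hI.2.1
    (N := (leftIdealGen k (mR '' (I : Set R))).comap DE.d) (fun i u hu j s hs hsj => ?_) hz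
  rw [Submodule.mem_comap, DE.d_mul hu (hm.map_mem hsj), ← hm.map_d]
  have hmem : ∀ {s}, s ∈ I → mR s ∈ leftIdealGen k (mR '' (I : Set R)) := fun hs =>
    subset_leftIdealGen _ (Set.mem_image_of_mem mR hs)
  exact Submodule.add_mem _ (mul_mem_leftIdealGen _ (hmem hs))
    (zsmul_mem (mul_mem_leftIdealGen _ (hmem (hI.2.2 s hs))) _)

end LeftIdeal

/-- The idealizer of a left ideal `M`: all `u` with `M u ⊆ M`. -/
def rightIdealizer {k E : Type} [Field k] [Ring E] [Algebra k E] (M : Submodule k E) :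
    Subalgebra k E where
  carrier := {u | ∀ z ∈ M, z * u ∈ M}
  mul_mem' ha hb z hz := by rw [← mul_assoc]; exact hb _ (ha z hz)
  add_mem' ha hb z hz := by rw [mul_add]; exact M.add_mem (ha z hz) (hb z hz)
  algebraMap_mem' r z hz := by
    rw [← Algebra.commutes, ← Algebra.smul_def]; exact M.smul_mem r hz

section Idealizer

variable {k E : Type} [Field k] [Ring E] [Algebra k E] {M : Submodule k E}

lemma mem_rightIdealizer {u : E} : u ∈ rightIdealizer M ↔ ∀ z ∈ M, z * u ∈ M := Iff.rfl

variable {ℰ : ℤ → Submodule k E}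

lemma mem_rightIdealizer_of_homogeneous (hM : IsGradedSubmodule k ℰ M) {u : E}
    (h : ∀ i, ∀ z ∈ M, z ∈ ℰ i → z * u ∈ M) : u ∈ rightIdealizer M := fun _ hz =>
  hM.induction (N := M.comap (LinearMap.mulRight k u)) h hz

variable [GradedAlgebra ℰ]

lemma proj_mem_rightIdealizer (hM : IsGradedSubmodule k ℰ M) {u : E}
    (hu : u ∈ rightIdealizer M) (i : ℤ) : GradedAlgebra.proj ℰ i u ∈ rightIdealizer M := by
  refine mem_rightIdealizer_of_homogeneous hM fun j z hz hzj => ?_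
  have := hM.proj_mem (hu z hz) (j + i)
  rwa [GradedAlgebra.proj_apply, DirectSum.coe_decompose_mul_add_of_left_mem ℰ hzj] at this

lemma d_mem_rightIdealizer (DE : DGAlgebra k E ℰ) (hM : IsGradedSubmodule k ℰ M)
    (hd : ∀ z ∈ M, DE.d z ∈ M) {u : E} (hu : u ∈ rightIdealizer M) :
    DE.d u ∈ rightIdealizer M := by
  obtain ⟨s, hs⟩ := sum_proj ℰ u
  rw [hs, map_sum]
  refine Subalgebra.sum_mem _ fun i _ => mem_rightIdealizer_of_homogeneous hM fun j z hz hzj => ?_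
  have hui := proj_mem_rightIdealizer hM hu i
  have h := hd _ (hui z hz)
  rw [DE.d_mul hzj (proj_mem ℰ i u), Submodule.add_mem_iff_right _ (hui _ (hd z hz))] at h
  rw [← sgn_smul_sgn_smul j (z * _)]
  exact zsmul_mem h _

/-- The restriction of the differential to a graded subalgebra stable under it. -/
def DGAlgebra.restrict (DE : DGAlgebra k E ℰ) (B : Subalgebra k E)
    (hd : ∀ b ∈ B, DE.d b ∈ B) :
    DGAlgebra k B fun i => (ℰ i).comap B.val.toLinearMap where
  d := DE.d.restrict (p := Subalgebra.toSubmodule B) (q := Subalgebra.toSubmodule B) hd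
  d_mem _ _ hb := DE.d_mem hb
  d_sq b := Subtype.ext (DE.d_sq b)
  d_mul _ _ _ _ ha hb := Subtype.ext (DE.d_mul ha hb)

end Idealizer

section EnvelopingAlgebra

variable {k R E : Type} [Field k] [Ring R] [Algebra k R] [Ring E] [Algebra k E]
  {𝒜 : ℤ → Submodule k R} {ℰ : ℤ → Submodule k E} [GradedAlgebra ℰ]
  {P : DGPoissonAlgebra k R 𝒜} {DE : DGAlgebra k E ℰ} {mR : R →ₐ[k] E} {hR : R →ₗ[k] E}

/-- A graded DG subalgebra of the universal enveloping algebra containing the images of both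
structure maps is everything. -/
lemma IsUEA.subalgebra_eq_top (hUEA : IsUEA k 𝒜 ℰ P DE mR hR) (B : Subalgebra k E)
    (hproj : ∀ b ∈ B, ∀ i, GradedAlgebra.proj ℰ i b ∈ B) (hd : ∀ b ∈ B, DE.d b ∈ B)
    (hm : ∀ a, mR a ∈ B) (hh : ∀ a, hR a ∈ B) : B = ⊤ := by
  obtain ⟨⟨hmR, h1, h2, h3, h4, h5⟩, huniv⟩ := hUEA
  let _ := gradedSubalgebra B hproj
  obtain ⟨φ, ⟨hφ, hφm, hφh⟩, -⟩ := huniv B _ (DE.restrict B hd) (mR.codRestrict B hm)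
    (hR.codRestrict (Subalgebra.toSubmodule B) hh)
    ⟨⟨fun _ _ ha => hmR.map_mem ha, fun a => Subtype.ext (hmR.map_d a)⟩,
      fun _ _ ha => h1 ha, fun a => Subtype.ext (h2 a),
      fun _ _ _ _ ha hb => Subtype.ext (h3 ha hb),
      fun _ _ _ _ ha hb => Subtype.ext (h4 ha hb),
      fun _ _ _ _ ha hb => Subtype.ext (h5 ha hb)⟩
  have key : B.val.comp φ = AlgHom.id k E :=
    (huniv E ℰ DE mR hR ⟨hmR, h1, h2, h3, h4, h5⟩).unique
      ⟨⟨fun _ _ ha => hφ.map_mem ha, fun a => congrArg Subtype.val (hφ.map_d a)⟩,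
        AlgHom.ext fun a => congrArg Subtype.val (DFunLike.congr_fun hφm a),
        LinearMap.ext fun a => congrArg Subtype.val (DFunLike.congr_fun hφh a)⟩
      ⟨⟨fun _ _ ha => ha, fun _ => rfl⟩, rfl, rfl⟩
  refine eq_top_iff.2 fun e _ => ?_
  rw [← AlgHom.id_apply (R := k) e, ← key]
  exact (φ e).2

variable [GradedAlgebra 𝒜]

lemma IsUEA.mul_mem_leftIdealGen_of_poisson (hUEA : IsUEA k 𝒜 ℰ P DE mR hR) {I : Submodule k R}
    (hI : IsDGIdeal k 𝒜 P.d I) (hbr : ∀ a : R, ∀ m ∈ I, P.br a m ∈ I) (u : E) {z : E}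
    (hz : z ∈ leftIdealGen k (mR '' (I : Set R))) :
    z * u ∈ leftIdealGen k (mR '' (I : Set R)) := by
  obtain ⟨hmR, -, -, -, hmbr, -⟩ := hUEA.1
  have hgr := isGradedSubmodule_leftIdealGen hI.2.1 hmR.map_mem
  have hmem : ∀ {s}, s ∈ I → mR s ∈ leftIdealGen k (mR '' (I : Set R)) := fun hs =>
    subset_leftIdealGen _ ⟨_, hs, rfl⟩
  suffices rightIdealizer (leftIdealGen k (mR '' (I : Set R))) = ⊤ from
    mem_rightIdealizer.1 (this ▸ Algebra.mem_top : u ∈ rightIdealizer _) z hz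
  refine hUEA.subalgebra_eq_top _ (fun _ hb => proj_mem_rightIdealizer hgr hb)
    (fun _ hb => d_mem_rightIdealizer DE hgr (fun _ => d_mem_leftIdealGen hI hmR) hb)
    (fun a z hz => ?_) (fun a z hz => ?_)
  · refine leftIdealGen_image_le ℰ mR hI.2.1 (N := (leftIdealGen k (mR '' (I : Set R))).comap
      (LinearMap.mulRight k (mR a))) (fun i u hu j s hs hsj => ?_) hz
    rw [Submodule.mem_comap, LinearMap.mulRight_apply, mul_assoc, ← map_mul]
    exact mul_mem_leftIdealGen _ (hmem (hI.1 a s hs).2)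
  · induction a using homogeneous_induction 𝒜 with
    | h0 => simp
    | hadd a b ha hb => rw [map_add, mul_add]; exact Submodule.add_mem _ ha hb
    | hp l a ha =>
      refine leftIdealGen_image_le ℰ mR hI.2.1 (N := (leftIdealGen k (mR '' (I : Set R))).comap
        (LinearMap.mulRight k (hR a))) (fun i u hu j s hs hsj => ?_) hz
      rw [Submodule.mem_comap, LinearMap.mulRight_apply, mul_assoc]
      refine mul_mem_leftIdealGen _ ?_
      have h : sgn (l * j) • (mR s * hR a) = hR a * mR s - mR (P.br a s) := by
        rw [hmbr ha hsj]; abel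
      rw [← sgn_smul_sgn_smul (l * j) (mR s * hR a), h]
      exact zsmul_mem (Submodule.sub_mem _ (mul_mem_leftIdealGen _ (hmem hs))
        (hmem (hbr a s hs))) _

omit [GradedAlgebra ℰ] in
lemma IsUEA.map_mem_leftIdealGen_iff (hUEA : IsUEA k 𝒜 ℰ P DE mR hR) (hs : SignTrivial k 𝒜)
    {I : Submodule k R} (hI : IsTwoSidedIdealSub k I) (r : R) :
    mR r ∈ leftIdealGen k (mR '' (I : Set R)) ↔ r ∈ I := by
  refine ⟨fun hr => ?_, fun hr => subset_leftIdealGen _ ⟨r, hr, rfl⟩⟩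
  obtain ⟨Φ, hΦ⟩ := P.exists_right_representation hs hUEA
  have h : leftIdealGen k (mR '' (I : Set R)) ≤ I.comap (LinearMap.applyₗ (1 : R) ∘ₗ
      (MulOpposite.opLinearEquiv k).symm.toLinearMap ∘ₗ Φ.toLinearMap) := by
    refine Submodule.span_le.2 ?_
    rintro _ ⟨u, _, ⟨s, hs, rfl⟩, rfl⟩
    change (Φ (u * mR s)).unop 1 ∈ I
    rw [map_mul, hΦ]
    exact (hI _ s hs).1
  have := h hr
  change (Φ (mR r)).unop 1 ∈ I at this
  rwa [hΦ, DGPoissonAlgebra.unop_rightMul_apply, one_mul] at this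

omit [GradedAlgebra ℰ] in
lemma IsUEA.br_mem_of_mul_mem (hUEA : IsUEA k 𝒜 ℰ P DE mR hR) (hs : SignTrivial k 𝒜)
    {I : Submodule k R} (hI : IsDGIdeal k 𝒜 P.d I)
    (hmul : ∀ z ∈ leftIdealGen k (mR '' (I : Set R)), ∀ u : E,
      z * u ∈ leftIdealGen k (mR '' (I : Set R))) (a : R) {m : R} (hm : m ∈ I) :
    P.br a m ∈ I := by
  obtain ⟨-, -, -, -, hmbr, -⟩ := hUEA.1
  induction a using homogeneous_induction 𝒜 with
  | h0 => simp
  | hadd a b ha hb => rw [map_add]; exact I.add_mem ha hb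
  | hp i a ha =>
    refine hI.2.1.induction (N := I.comap (P.br a)) (fun j m hm hmj => ?_) hm
    have hmem : mR m ∈ leftIdealGen k (mR '' (I : Set R)) :=
      subset_leftIdealGen _ ⟨m, hm, rfl⟩
    rw [Submodule.mem_comap, ← hUEA.map_mem_leftIdealGen_iff hs hI.1, hmbr ha hmj]
    exact Submodule.sub_mem _ (mul_mem_leftIdealGen _ hmem) (zsmul_mem (hmul _ hmem _) _)

end EnvelopingAlgebra

/-- If `R` is spanned by monomials in elements of even degree, it vanishes in odd degrees. -/
lemma eq_bot_of_odd_of_span_xMono {k R : Type} [Field k] [Ring R] [Algebra k R] {n : ℕ}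
    {𝒜 : ℤ → Submodule k R} [GradedAlgebra 𝒜] {x : Fin n → R} {w : Fin n → ℤ}
    (hx : ∀ i, x i ∈ 𝒜 (w i)) (hw : ∀ i, Even (w i))
    (hspan : Submodule.span k (Set.range fun e : Fin n → ℕ => xMono x e) = ⊤)
    {i : ℤ} (hi : Odd i) : 𝒜 i = ⊥ := by
  have hle : (⊤ : Submodule k R) ≤ LinearMap.ker (GradedAlgebra.proj 𝒜 i) := by
    rw [← hspan, Submodule.span_le]
    rintro _ ⟨e, rfl⟩
    have hmem : xMono x e ∈ 𝒜 (((List.finRange n).map fun r => e r • w r).sum) :=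
      SetLike.list_prod_map_mem_graded _ _ _ fun r _ => SetLike.pow_mem_graded _ (hx r)
    refine proj_ne 𝒜 hmem fun h => Int.not_even_iff_odd.2 hi (h ▸ ?_)
    rw [even_iff_two_dvd]
    refine List.dvd_sum fun y hy => ?_
    obtain ⟨r, -, rfl⟩ := List.mem_map.1 hy
    exact ((hw r).two_dvd).trans ⟨e r, by simp [mul_comm]⟩
  refine (Submodule.eq_bot_iff _).2 fun a ha => ?_
  rw [← proj_same 𝒜 ha]
  exact hle trivial

/-- Assume `char k = 2` or every `|x_i|` is even, so that the
monomials form a `k`-basis of `R`.  For a DG ideal `I` of `R`, let `Ī` be the left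
ideal of `R^e` generated by `m_R(I)`.  Then `m_R⁻¹(Ī) = I`; the assignment `I ↦ Ī` is
an injective, inclusion-preserving map from DG ideals of `R` to left DG ideals of
`R^e`; and `I` is a DG Poisson ideal of `R` iff `Ī` is a two-sided ideal of `R^e`
closed under the differential. -/
theorem stmt12 (k R E : Type) [Field k] [Ring R] [Algebra k R] [Ring E] [Algebra k E]
    (n : ℕ) (𝒜 : ℤ → Submodule k R) [GradedAlgebra 𝒜]
    (ℰ : ℤ → Submodule k E) [GradedAlgebra ℰ]
    (P : DGPoissonAlgebra k R 𝒜)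
    (x : Fin n → R) (w : Fin n → ℤ) (hx : ∀ i, x i ∈ 𝒜 (w i))
    (hgen : Algebra.adjoin k (Set.range x) = ⊤)
    (hchar : ringChar k = 2 ∨ ∀ i, Even (w i))
    (hbasis : LinearIndependent k (fun e : Fin n → ℕ => xMono x e) ∧
      Submodule.span k (Set.range fun e : Fin n → ℕ => xMono x e) = ⊤)
    (DE : DGAlgebra k E ℰ) (mR : R →ₐ[k] E) (hR : R →ₗ[k] E)
    (hUEA : IsUEA k 𝒜 ℰ P DE mR hR) :
    -- `m_R⁻¹(Ī) = I`
    (∀ I : Submodule k R, IsDGIdeal k 𝒜 P.d I →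
      ∀ r : R, mR r ∈ leftIdealGen k (⇑mR '' (I : Set R)) ↔ r ∈ I) ∧
    -- `Ī` is a left DG ideal of `R^e`
    (∀ I : Submodule k R, IsDGIdeal k 𝒜 P.d I →
      (∀ u : E, ∀ z ∈ leftIdealGen k (⇑mR '' (I : Set R)),
        u * z ∈ leftIdealGen k (⇑mR '' (I : Set R))) ∧
      IsGradedSubmodule k ℰ (leftIdealGen k (⇑mR '' (I : Set R))) ∧
      (∀ z ∈ leftIdealGen k (⇑mR '' (I : Set R)),
        DE.d z ∈ leftIdealGen k (⇑mR '' (I : Set R)))) ∧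
    -- `I ↦ Ī` is injective
    (∀ I I' : Submodule k R, IsDGIdeal k 𝒜 P.d I → IsDGIdeal k 𝒜 P.d I' →
      leftIdealGen k (⇑mR '' (I : Set R)) = leftIdealGen k (⇑mR '' (I' : Set R)) →
      I = I') ∧
    -- `I ↦ Ī` preserves inclusions
    (∀ I I' : Submodule k R, IsDGIdeal k 𝒜 P.d I → IsDGIdeal k 𝒜 P.d I' → I ≤ I' →
      leftIdealGen k (⇑mR '' (I : Set R)) ≤ leftIdealGen k (⇑mR '' (I' : Set R))) ∧
    -- `I` is DG Poisson iff `Ī` is a two-sided DG ideal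
    (∀ I : Submodule k R, IsDGIdeal k 𝒜 P.d I →
      ((∀ a : R, ∀ m ∈ I, P.br a m ∈ I) ↔
        ((∀ z ∈ leftIdealGen k (⇑mR '' (I : Set R)), ∀ u : E,
            z * u ∈ leftIdealGen k (⇑mR '' (I : Set R))) ∧
          (∀ z ∈ leftIdealGen k (⇑mR '' (I : Set R)),
            DE.d z ∈ leftIdealGen k (⇑mR '' (I : Set R)))))) := by
  have hs : SignTrivial k 𝒜 := hchar.imp
    (fun h => by
      have : CharP k 2 := ringChar.of_eq h
      exact_mod_cast CharP.cast_eq_zero k 2)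
    fun h i hi => eq_bot_of_odd_of_span_xMono hx h hbasis.2 hi
  have hmap := fun (I : Submodule k R) (hI : IsDGIdeal k 𝒜 P.d I) =>
    hUEA.map_mem_leftIdealGen_iff hs hI.1
  have hmR := hUEA.1.1
  refine ⟨hmap, fun I hI => ⟨fun u z => mul_mem_leftIdealGen u,
      isGradedSubmodule_leftIdealGen hI.2.1 hmR.map_mem, fun z => d_mem_leftIdealGen hI hmR⟩,
    fun I I' hI hI' h => Submodule.ext fun r => ?_,
    fun I I' _ _ h => leftIdealGen_mono (Set.image_mono h), fun I hI => ⟨fun h => ⟨?_, ?_⟩, ?_⟩⟩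
  · rw [← hmap I hI, ← hmap I' hI', h]
  · exact fun z hz u => hUEA.mul_mem_leftIdealGen_of_poisson hI h u hz
  · exact fun z => d_mem_leftIdealGen hI hmR
  · exact fun h a m hm => hUEA.br_mem_of_mul_mem hs hI h.1 a hm
end
end
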